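/- arXiv:2003.13738 — 2 statements merged into one kernel-verified Lean document; each statement's English description precedes it below -/
import Mathlib

section
/- Let p be a prime, d a natural number, and A a d×d matrix with entries in ℤ_p. Then the sequence r ↦ A^{r!} converges in the space of d×d matrices over ℤ_p (equipped with the topology induced by the p-adic norm on each entry), and its limit e satisfies e·e = e and A·e = e·A. -/
open Filter

/-- In a finite monoid, the factorial powers of an element are eventually constant, with
idempotent eventual value. -/
theorem Finite.exists_pow_factorial_eventually_const {M : Type*} [Monoid M] [Finite M] (x : M) :
    ∃ N : ℕ, ∀ r ≥ N, x ^ r.factorial = x ^ N.factorial ∧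
      x ^ r.factorial * x ^ r.factorial = x ^ r.factorial := by
  obtain ⟨a, b, hab, h⟩ : ∃ a b : ℕ, a < b ∧ x ^ a = x ^ b := by
    obtain ⟨a, b, hne, h⟩ := Finite.exists_ne_map_eq_of_infinite (fun n : ℕ => x ^ n)
    rcases hne.lt_or_gt with hlt | hlt
    exacts [⟨a, b, hlt, h⟩, ⟨b, a, hlt, h.symm⟩]
  have periodic (n m : ℕ) (hn : a ≤ n) : x ^ (n + (b - a) * m) = x ^ n := by
    induction m with
    | zero => simp
    | succ m ih =>
      have e1 : n + (b - a) * (m + 1) = b + (n - a + (b - a) * m) := by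
        rw [mul_add]; omega
      have e2 : n + (b - a) * m = a + (n - a + (b - a) * m) := by omega
      rw [e1, pow_add, ← h, ← pow_add, ← e2, ih]
  have hdvd (r : ℕ) (hr : b ≤ r) : b - a ∣ r.factorial :=
    Nat.dvd_factorial (by omega) (by omega)
  have hle (r : ℕ) (hr : b ≤ r) : a ≤ r.factorial := by
    have := r.self_le_factorial
    omega
  refine ⟨b, fun r hr => ⟨?_, ?_⟩⟩
  · obtain ⟨m, hm⟩ := Nat.dvd_sub (hdvd r hr) (hdvd b le_rfl)
    have := Nat.factorial_le hr
    rw [show r.factorial = b.factorial + (b - a) * m by omega, periodic _ _ (hle b le_rfl)]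
  · obtain ⟨m, hm⟩ := hdvd r hr
    rw [← pow_add]
    nth_rewrite 2 [hm]
    exact periodic _ _ (hle r hr)

theorem PadicInt.dist_le_of_toZModPow_eq {p : ℕ} [Fact p.Prime] {n : ℕ} {x y : ℤ_[p]}
    (h : toZModPow n x = toZModPow n y) : dist x y ≤ (p : ℝ) ^ (-n : ℤ) := by
  rw [dist_eq_norm, norm_le_pow_iff_mem_span_pow, ← ker_toZModPow, RingHom.mem_ker, map_sub, h,
    sub_self]

/-- The entries of the factorial powers of a `p`-adic integer matrix are eventually constant, and
eventually agree with those of their squares, to any prescribed precision. -/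
theorem PadicInt.exists_dist_pow_factorial_lt {p : ℕ} [Fact p.Prime] {ι : Type*} [Fintype ι]
    [DecidableEq ι] (A : Matrix ι ι ℤ_[p]) {ε : ℝ} (hε : 0 < ε) :
    ∃ N : ℕ, ∀ r ≥ N, ∀ i j,
      dist ((A ^ r.factorial) i j) ((A ^ N.factorial) i j) < ε ∧
      dist ((A ^ r.factorial * A ^ r.factorial) i j) ((A ^ r.factorial) i j) < ε := by
  obtain ⟨n, hn⟩ := exists_pow_neg_lt p hε
  have : NeZero (p ^ n) := ⟨pow_ne_zero n (Fact.out : p.Prime).ne_zero⟩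
  let φ := (toZModPow (p := p) n).mapMatrix (m := ι)
  obtain ⟨N, hN⟩ := Finite.exists_pow_factorial_eventually_const (φ A)
  have entry {B C : Matrix ι ι ℤ_[p]} (h : φ B = φ C) (i j : ι) : dist (B i j) (C i j) < ε :=
    (dist_le_of_toZModPow_eq (congrFun (congrFun h i) j)).trans_lt hn
  refine ⟨N, fun r hr i j => ⟨entry ?_ i j, entry ?_ i j⟩⟩
  · simpa only [map_pow] using (hN r hr).1
  · simpa only [map_pow, map_mul] using (hN r hr).2

/-- for a square matrix `A` over `ℤ_p`, the sequence of factorial powers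
`A^(r!)` converges, and its limit `e` (Hida's ordinary projector) is an idempotent
commuting with `A`. -/
theorem hida_ordinary_projector_exists (p : ℕ) [Fact p.Prime] (d : ℕ)
    (A : Matrix (Fin d) (Fin d) ℤ_[p]) :
    ∃ e : Matrix (Fin d) (Fin d) ℤ_[p],
      Tendsto (fun r : ℕ => A ^ r.factorial) atTop (nhds e) ∧
      e * e = e ∧ A * e = e * A := by
  have cauchy (i j : Fin d) : CauchySeq fun r : ℕ => (A ^ r.factorial) i j := by
    refine Metric.cauchySeq_iff'.2 fun ε hε => ?_
    obtain ⟨N, hN⟩ := PadicInt.exists_dist_pow_factorial_lt A hε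
    exact ⟨N, fun r hr => (hN r hr i j).1⟩
  choose e he using fun i j => cauchySeq_tendsto_of_complete (cauchy i j)
  have lim : Tendsto (fun r : ℕ => A ^ r.factorial) atTop (nhds (Matrix.of e)) :=
    tendsto_pi_nhds.2 fun i => tendsto_pi_nhds.2 fun j => he i j
  refine ⟨Matrix.of e, lim, ?_, ?_⟩
  · ext1 i j
    have sq := tendsto_pi_nhds.1 (tendsto_pi_nhds.1 (lim.mul lim) i) j
    refine tendsto_nhds_unique sq ((he i j).congr_dist ?_)
    refine Metric.tendsto_atTop.2 fun ε hε => ?_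
    obtain ⟨N, hN⟩ := PadicInt.exists_dist_pow_factorial_lt A hε
    refine ⟨N, fun r hr => ?_⟩
    rw [Real.dist_0_eq_abs, abs_of_nonneg dist_nonneg, dist_comm]
    exact (hN r hr i j).2
  · refine tendsto_nhds_unique (lim.const_mul A) ((lim.mul_const A).congr fun r => ?_)
    rw [← pow_succ, pow_succ']
end

section
/- Let p be a prime, d a natural number, A a d×d matrix with entries in ℤ_p, and let e be the limit of the sequence r ↦ A^{r!} in the space of d×d matrices over ℤ_p. Regarding A and e as ℤ_p-linear endomorphisms of M = ℤ_p^d, the restriction of A to the submodule e(M) is a ℤ_p-linear automorphism of e(M), and for every x ∈ M with e(x) = 0 the sequence A^{r!}(x) converges to 0. -/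
open Filter

/-- The congruence class of a matrix over `ℤ_p` modulo `p ^ n` is a neighbourhood of it. -/
lemma eventually_toZModPow_mapMatrix_eq {p : ℕ} [Fact p.Prime] {d : ℕ}
    (e : Matrix (Fin d) (Fin d) ℤ_[p]) (n : ℕ) :
    ∀ᶠ M in nhds e,
      (PadicInt.toZModPow n).mapMatrix M = (PadicInt.toZModPow n).mapMatrix e := by
  have entry (i j : Fin d) : ∀ᶠ M in nhds e,
      PadicInt.toZModPow n (M i j) = PadicInt.toZModPow n (e i j) := by
    have hc : Tendsto (fun M : Matrix (Fin d) (Fin d) ℤ_[p] => M i j) (nhds e) (nhds (e i j)) :=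
      (continuous_id.matrix_elem i j).tendsto e
    have hp : (0 : ℝ) < (p : ℝ) ^ (-n : ℤ) :=
      zpow_pos (by exact_mod_cast (Fact.out : p.Prime).pos) _
    filter_upwards [hc (Metric.ball_mem_nhds _ hp)] with M hM
    rw [← sub_eq_zero, ← map_sub, ← RingHom.mem_ker, PadicInt.ker_toZModPow,
      ← PadicInt.norm_le_pow_iff_mem_span_pow, ← dist_eq_norm]
    exact (Metric.mem_ball.mp hM).le
  filter_upwards [eventually_all.mpr fun i => eventually_all.mpr (entry i)] with M hM
  ext i j
  exact hM i j

/-- A limit of factorial powers of a matrix over `ℤ_p` is idempotent. -/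
lemma isIdempotentElem_of_tendsto_pow_factorial {p : ℕ} [Fact p.Prime] {d : ℕ}
    {A e : Matrix (Fin d) (Fin d) ℤ_[p]}
    (he : Tendsto (fun r : ℕ => A ^ r.factorial) atTop (nhds e)) : IsIdempotentElem e := by
  ext i j
  refine PadicInt.ext_of_toZModPow.mp fun n => ?_
  obtain ⟨R, hR⟩ := eventually_atTop.mp (he.eventually (eventually_toZModPow_mapMatrix_eq e n))
  set f := (PadicInt.toZModPow (p := p) n).mapMatrix (m := Fin d)
  have hpow (r : ℕ) (hr : R ≤ r) : f e ^ (r + 1) = f e := by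
    rw [← hR r hr, ← map_pow, ← pow_mul, mul_comm, ← Nat.factorial_succ, hR (r + 1) (by lia),
      hR r hr]
  have h : f (e * e) = f e := by
    calc f (e * e) = f e * f e ^ (R + 1) := by rw [hpow R le_rfl, map_mul]
      _ = f e := by rw [← pow_succ', hpow (R + 1) (by lia)]
  exact congrFun (congrFun h i) j

/-- if `e = lim A^(r!)` is Hida's ordinary projector of a matrix `A` over
`ℤ_p`, then `A` restricts to a `ℤ_p`-linear automorphism of the ordinary part
`e(ℤ_p^d)`, and `A^(r!)(x) → 0` whenever `e(x) = 0`. -/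
theorem hida_projector_ordinary_part (p : ℕ) [Fact p.Prime] (d : ℕ)
    (A e : Matrix (Fin d) (Fin d) ℤ_[p])
    (he : Tendsto (fun r : ℕ => A ^ r.factorial) atTop (nhds e)) :
    (∃ φ : LinearMap.range (Matrix.toLin' e) ≃ₗ[ℤ_[p]] LinearMap.range (Matrix.toLin' e),
        ∀ x : LinearMap.range (Matrix.toLin' e),
          (φ x : Fin d → ℤ_[p]) = Matrix.toLin' A (x : Fin d → ℤ_[p])) ∧
    (∀ x : Fin d → ℤ_[p], Matrix.toLin' e x = 0 →
        Tendsto (fun r : ℕ => Matrix.toLin' (A ^ r.factorial) x) atTop (nhds 0)) := by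
  have hlim (x : Fin d → ℤ_[p]) : Tendsto (fun r : ℕ => Matrix.toLin' (A ^ r.factorial) x) atTop
      (nhds (Matrix.toLin' e x)) := by
    simp only [Matrix.toLin'_apply]
    exact ((continuous_id.matrix_mulVec continuous_const).tendsto e).comp he
  refine ⟨?_, fun x hx => hx ▸ hlim x⟩
  have hidem := isIdempotentElem_of_tendsto_pow_factorial he
  have hcomm : A * e = e * A := by
    refine tendsto_nhds_unique (he.const_mul A) ?_
    simpa only [← pow_succ, ← pow_succ'] using he.mul_const A
  have hfix (x : LinearMap.range (Matrix.toLin' e)) : Matrix.toLin' e x = x := by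
    obtain ⟨_, y, rfl⟩ := x
    rw [← Matrix.toLin'_mul_apply, hidem.eq]
  have hmaps (x) (hx : x ∈ LinearMap.range (Matrix.toLin' e)) :
      Matrix.toLin' A x ∈ LinearMap.range (Matrix.toLin' e) := by
    obtain ⟨y, rfl⟩ := hx
    exact ⟨Matrix.toLin' A y, by rw [← Matrix.toLin'_mul_apply, ← Matrix.toLin'_mul_apply, hcomm]⟩
  have hsplit (r : ℕ) : A ^ r.factorial = A ^ (r.factorial - 1) * A := by
    rw [← pow_succ, Nat.sub_add_cancel r.factorial_pos]
  have hsplit' (r : ℕ) : A ^ r.factorial = A * A ^ (r.factorial - 1) := by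
    rw [← pow_succ', Nat.sub_add_cancel r.factorial_pos]
  refine ⟨LinearEquiv.ofBijective ((Matrix.toLin' A).restrict hmaps) ⟨?_, ?_⟩, fun x => rfl⟩
  · refine (injective_iff_map_eq_zero _).mpr fun x hx => ?_
    have hAx : Matrix.toLin' A (x : Fin d → ℤ_[p]) = 0 := congrArg Subtype.val hx
    refine Subtype.ext ((hfix x).symm.trans (tendsto_nhds_unique (hlim x) ?_))
    simp only [hsplit, Matrix.toLin'_mul_apply, hAx, map_zero]
    exact tendsto_const_nhds
  · intro x
    -- `x = lim A (A ^ (r! - 1) x)`, and the image of `A * e` is compact, hence closed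
    have hclosed : IsClosed (Set.range (Matrix.toLin' (A * e))) :=
      (isCompact_range (LinearMap.continuous_on_pi _)).isClosed
    have hmem : (x : Fin d → ℤ_[p]) ∈ Set.range (Matrix.toLin' (A * e)) := by
      refine hclosed.mem_of_tendsto (hfix x ▸ hlim x) (Eventually.of_forall fun r => ?_)
      refine ⟨Matrix.toLin' (A ^ (r.factorial - 1)) x, ?_⟩
      have hc : e * A ^ (r.factorial - 1) = A ^ (r.factorial - 1) * e :=
        (Commute.pow_left (show Commute A e from hcomm) _).eq.symm
      rw [← Matrix.toLin'_mul_apply, mul_assoc, hc, ← mul_assoc, ← hsplit',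
        Matrix.toLin'_mul_apply, hfix]
    obtain ⟨y, hy⟩ := hmem
    exact ⟨⟨Matrix.toLin' e y, y, rfl⟩, Subtype.ext (by rw [← hy, Matrix.toLin'_mul_apply]; rfl)⟩
end
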